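/- arXiv:2305.08331 — 2 statements merged into one kernel-verified Lean document; each statement's English description precedes it below -/
import Mathlib

section
/- Let H be a C4-free Halin graph with characteristic tree T whose longest path has length at least 6. Then at least one of the following holds: (i) T contains a semi-branching vertex of degree at least 4; (ii) there is a path (u, v, w) in T with v a semi-branching vertex of degree 3 in T such that the bounded face of H incident to the path (u, v, w) has size at least 6; (iii) there is a tree edge e ∈ E(T) whose two endpoints are both non-leaf vertices of T such that both bounded faces of H incident to e have size at least 6. -/
open SimpleGraph

/-- Degree of a vertex as the `ncard` of its neighbour set. -/
noncomputable def ncDeg {V : Type*} (G : SimpleGraph V) (v : V) : ℕ :=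
  (G.neighborSet v).ncard

/-- A leaf is a vertex of degree one. -/
def IsLeaf {V : Type*} (G : SimpleGraph V) (v : V) : Prop :=
  ncDeg G v = 1

/-- A Halin graph, presented by its characteristic tree `T` and outer cycle `C`.
The underlying graph is `T ⊔ C`.  The outer cycle is a `2`-regular connected graph
whose support is exactly the set of leaves of `T`, every non-leaf of `T` has degree
at least three, and the cycle is compatible with a planar embedding: for every edge
`uv` of `T`, the leaves lying in each component of `T - uv` are consecutive on the
cycle, i.e. they induce a connected subgraph of the cycle. -/
structure HalinGraph (V : Type*) [Fintype V] : Type _ where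
  /-- the characteristic tree -/
  T : SimpleGraph V
  /-- the outer cycle -/
  C : SimpleGraph V
  tree_isTree : T.IsTree
  four_le_card : 4 ≤ Fintype.card V
  nonleaf_degree : ∀ v : V, ¬ IsLeaf T v → 3 ≤ ncDeg T v
  support_C : C.support = {v : V | IsLeaf T v}
  two_regular : ∀ v ∈ C.support, ncDeg C v = 2
  cycle_connected : (C.induce C.support).Connected
  planar : ∀ u v : V, T.Adj u v →
    (C.induce {x : V | IsLeaf T x ∧ (T.deleteEdges {s(u, v)}).Reachable u x}).Connected

/-- The Halin graph itself: the (edge-disjoint) union of the tree and the outer cycle. -/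
def HalinGraph.graph {V : Type*} [Fintype V] (H : HalinGraph V) : SimpleGraph V :=
  H.T ⊔ H.C

/-- Number of edges of a graph. -/
noncomputable def eCount {V : Type*} (G : SimpleGraph V) : ℕ :=
  G.edgeSet.ncard

/-- A graph is `C₄`-free iff it contains no cycle of length `4`. -/
def C4Free {V : Type*} (G : SimpleGraph V) : Prop :=
  ∀ (v : V) (w : G.Walk v v), w.IsCycle → w.length ≠ 4

/-- A semi-branching vertex of the characteristic tree: a non-leaf with at least one
leaf neighbour and at least two non-leaf neighbours. -/
def SemiBranching {V : Type*} (T : SimpleGraph V) (v : V) : Prop :=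
  ¬ IsLeaf T v ∧ (∃ x, T.Adj v x ∧ IsLeaf T x) ∧
    ∃ x y : V, x ≠ y ∧ T.Adj v x ∧ T.Adj v y ∧ ¬ IsLeaf T x ∧ ¬ IsLeaf T y

theorem IsLeaf.eq_of_adj {V : Type*} {G : SimpleGraph V} {v a b : V} (hv : IsLeaf G v)
    (ha : G.Adj v a) (hb : G.Adj v b) : a = b := by
  obtain ⟨c, hc⟩ := Set.ncard_eq_one.1 hv
  have hac : a ∈ G.neighborSet v := ha
  have hbc : b ∈ G.neighborSet v := hb
  rw [hc] at hac hbc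
  exact hac.trans hbc.symm

/-- In a graph on a finite vertex set, a vertex of degree at most three has no neighbour besides
three given distinct ones. -/
theorem eq_of_adj_of_ncDeg_le_three {V : Type*} [Finite V] {G : SimpleGraph V} {v a b c x : V}
    (hv : ncDeg G v ≤ 3) (ha : G.Adj v a) (hb : G.Adj v b) (hc : G.Adj v c)
    (hab : a ≠ b) (hac : a ≠ c) (hbc : b ≠ c) (hx : G.Adj v x) : x = a ∨ x = b ∨ x = c := by
  have hsub : ({a, b, c} : Set V) ⊆ G.neighborSet v := by
    rintro y (rfl | rfl | rfl) <;> assumption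
  have hcard : ({a, b, c} : Set V).ncard = 3 := Set.ncard_eq_three.2 ⟨a, b, c, hab, hac, hbc, rfl⟩
  have heq := Set.eq_of_subset_of_ncard_le hsub (by rw [hcard]; exact hv) (Set.toFinite _)
  have hmem : x ∈ G.neighborSet v := hx
  rw [← heq] at hmem
  simpa using hmem

/-- A connected induced subgraph has an edge leaving any proper part of it. -/
theorem exists_adj_of_connected_induce {V : Type*} {G : SimpleGraph V} {S A : Set V} {a b : V}
    (hS : (G.induce S).Connected) (ha : a ∈ S) (hb : b ∈ S) (haA : a ∈ A) (hbA : b ∉ A) :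
    ∃ x ∈ S, ∃ y ∈ S, G.Adj x y ∧ x ∈ A ∧ y ∉ A := by
  obtain ⟨w⟩ := hS ⟨a, ha⟩ ⟨b, hb⟩
  obtain ⟨d, -, h1, h2⟩ := w.exists_boundary_dart {x : S | x.1 ∈ A} haA hbA
  exact ⟨d.fst, d.fst.2, d.snd, d.snd.2, d.adj, h1, h2⟩

namespace SimpleGraph.Walk

variable {V : Type*} {G : SimpleGraph V} {a b : V} {p : G.Walk a b}

/-- A non-leaf without leaf neighbours lies at distance at least two from the start of any walk
that starts at a leaf and passes through it. -/
theorem two_le_of_getVert_eq (ha : IsLeaf G a) {i : ℕ} (hi : i ≤ p.length) {u : V}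
    (hu : p.getVert i = u) (hu1 : ¬ IsLeaf G u) (hu2 : ∀ x, G.Adj u x → ¬ IsLeaf G x) :
    2 ≤ i := by
  by_contra! hlt
  obtain rfl | rfl : i = 0 ∨ i = 1 := by omega
  · rw [getVert_zero] at hu
    exact hu1 (hu ▸ ha)
  · have h := p.adj_getVert_succ (i := 0) (by omega)
    rw [getVert_zero, zero_add, hu] at h
    exact hu2 _ h.symm ha

/-- The mirror image of `two_le_of_getVert_eq`. -/
theorem add_two_le_of_getVert_eq (hb : IsLeaf G b) {i : ℕ} (hi : i ≤ p.length)
    {u : V} (hu : p.getVert i = u) (hu1 : ¬ IsLeaf G u)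
    (hu2 : ∀ x, G.Adj u x → ¬ IsLeaf G x) : i + 2 ≤ p.length := by
  have h := p.reverse.two_le_of_getVert_eq hb (i := p.length - i) (by simp)
    (by rw [getVert_reverse, Nat.sub_sub_self hi, hu]) hu1 hu2
  omega

/-- Every walk between leaves through an edge whose ends are non-leaves without leaf neighbours
has length at least five. -/
theorem five_le_length_of_mem_edges (ha : IsLeaf G a) (hb : IsLeaf G b) {u v : V}
    (huv : s(u, v) ∈ p.edges) (hu1 : ¬ IsLeaf G u) (hu2 : ∀ x, G.Adj u x → ¬ IsLeaf G x)
    (hv1 : ¬ IsLeaf G v) (hv2 : ∀ x, G.Adj v x → ¬ IsLeaf G x) : 5 ≤ p.length := by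
  obtain ⟨i, hi, h⟩ := (mk_mem_edges_iff_exists p).1 huv
  rcases Sym2.eq_iff.1 h with ⟨h1, h2⟩ | ⟨h1, h2⟩
  · have := p.two_le_of_getVert_eq ha hi.le h1 hu1 hu2
    have := p.add_two_le_of_getVert_eq hb (i := i + 1) hi h2 hv1 hv2
    omega
  · have := p.two_le_of_getVert_eq ha hi.le h1 hv1 hv2
    have := p.add_two_le_of_getVert_eq hb (i := i + 1) hi h2 hu1 hu2
    omega

end SimpleGraph.Walk

namespace SimpleGraph.Walk.IsPath

variable {V : Type*} {G : SimpleGraph V} {a b : V} {p : G.Walk a b}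

theorem getVert_ne (hp : p.IsPath) {i j : ℕ} (hi : i ≤ p.length) (hj : j ≤ p.length)
    (hij : i ≠ j) : p.getVert i ≠ p.getVert j :=
  fun h ↦ hij (hp.getVert_injOn hi hj h)

theorem not_isLeaf_getVert (hp : p.IsPath) {i : ℕ} (h0 : 0 < i) (hi : i < p.length) :
    ¬ IsLeaf G (p.getVert i) := by
  obtain ⟨j, rfl⟩ : ∃ j, i = j + 1 := ⟨i - 1, by omega⟩
  intro h
  exact hp.getVert_ne (by omega) (by omega) (by omega)
    (h.eq_of_adj (p.adj_getVert_succ (i := j) (by omega)).symm (p.adj_getVert_succ hi))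

/-- A path can be extended at its start in an acyclic graph by any neighbour other than its second
vertex. -/
theorem cons_of_isAcyclic (hp : p.IsPath) (hG : G.IsAcyclic) {x : V} (h : G.Adj x a)
    (hx : x ≠ p.snd) : (p.cons h).IsPath :=
  (cons_isPath_iff h p).2 ⟨hp, fun hmem ↦ hx (hG.eq_snd_of_adj_start hp h.symm hmem)⟩

/-- All neighbours of the second vertex of a longest path, except possibly the third vertex of the
path, are leaves. -/
theorem isLeaf_of_adj_getVert_one (hp : p.IsPath) (hG : G.IsAcyclic)
    (hmax : ∀ (c d : V) (q : G.Walk c d), q.IsPath → q.length ≤ p.length)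
    (hlen : 2 ≤ p.length) {x : V} (hx : G.Adj (p.getVert 1) x) (hx2 : x ≠ p.getVert 2) :
    IsLeaf G x := by
  by_contra hleaf
  obtain ⟨y, hy, hy1⟩ : ∃ y, G.Adj x y ∧ y ≠ p.getVert 1 := by
    by_contra! hall
    refine hleaf (Set.ncard_eq_one.2 ⟨p.getVert 1, Set.ext fun y ↦ ⟨hall y, ?_⟩⟩)
    rintro rfl
    exact hx.symm
  have hq : ((p.drop 1).cons hx.symm).IsPath := by
    refine (hp.drop 1).cons_of_isAcyclic hG hx.symm ?_
    rw [snd, drop_getVert]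
    exact hx2
  have hr : (((p.drop 1).cons hx.symm).cons hy.symm).IsPath := by
    refine hq.cons_of_isAcyclic hG hy.symm ?_
    simpa using hy1
  have := hmax _ _ _ hr
  simp only [length_cons, drop_length] at this
  omega

end SimpleGraph.Walk.IsPath

/-- Removing the edge at a leaf of a connected graph separates no other vertex from the leaf's
neighbour. -/
theorem IsLeaf.reachable_deleteEdges {V : Type*} {G : SimpleGraph V} (hG : G.Connected)
    {v x y : V} (hx : IsLeaf G x) (hvx : G.Adj v x) (hyx : y ≠ x) :
    (G.deleteEdges {s(v, x)}).Reachable v y := by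
  obtain ⟨p, hp, -⟩ := hG.exists_path_of_dist v y
  refine reachable_deleteEdges_iff_exists_walk.2 ⟨p, fun hmem ↦ ?_⟩
  obtain ⟨i, hi, hxi⟩ :=
    (Walk.mem_support_iff_exists_getVert).1 (p.snd_mem_support_of_mem_edges hmem)
  refine hp.not_isLeaf_getVert (i := i) ?_ ?_ (hi ▸ hx)
  · refine Nat.pos_of_ne_zero ?_
    rintro rfl
    rw [Walk.getVert_zero] at hi
    exact hvx.ne hi
  · refine lt_of_le_of_ne hxi ?_
    rintro rfl
    rw [Walk.getVert_length] at hi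
    exact hyx hi

theorem C4Free.not_adj {V : Type*} {G : SimpleGraph V} (hG : C4Free G) {a b c d : V}
    (hab : G.Adj a b) (hbc : G.Adj b c) (hcd : G.Adj c d) (hac : a ≠ c) (hbd : b ≠ d) :
    ¬ G.Adj d a := by
  intro hda
  refine hG a (.cons hab (.cons hbc (.cons hcd (.cons hda .nil)))) ?_ rfl
  have := hab.ne
  have := hbc.ne
  have := hcd.ne
  have := hda.ne
  rw [Walk.cons_isCycle_iff]
  simp only [Walk.cons_isPath_iff, Walk.IsPath.nil, Walk.support_cons, Walk.support_nil,
    Walk.edges_cons, Walk.edges_nil, List.mem_cons, List.not_mem_nil, Sym2.eq_iff]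
  grind

namespace HalinGraph

variable {V : Type*} [Fintype V] (H : HalinGraph V)

theorem isLeaf_left_of_adj {x y : V} (h : H.C.Adj x y) : IsLeaf H.T x := by
  have : x ∈ H.C.support := ⟨y, h⟩
  rwa [H.support_C] at this

theorem not_reachable_deleteEdges {u v : V} (h : H.T.Adj u v) :
    ¬ (H.T.deleteEdges {s(u, v)}).Reachable u v :=
  isBridge_iff.1 (isAcyclic_iff_forall_adj_isBridge.1 H.tree_isTree.isAcyclic h)

/-- In a `C₄`-free Halin graph, the third vertex of a longest path of the characteristic tree has no
leaf neighbour, provided its degree is at most three. -/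
theorem not_isLeaf_of_adj_getVert_two (hfree : C4Free H.graph) {a b : V} {p : H.T.Walk a b}
    (hp : p.IsPath) (hmax : ∀ (c d : V) (q : H.T.Walk c d), q.IsPath → q.length ≤ p.length)
    (hlen : 4 ≤ p.length) (hdeg : ncDeg H.T (p.getVert 2) ≤ 3) {x : V}
    (hx : H.T.Adj (p.getVert 2) x) : ¬ IsLeaf H.T x := by
  intro hxl
  have hac := H.tree_isTree.isAcyclic
  have h01 := p.adj_getVert_succ (i := 0) (by omega)
  have h12 := p.adj_getVert_succ (i := 1) (by omega)
  have h23 := p.adj_getVert_succ (i := 2) (by omega)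
  simp only [Nat.reduceAdd] at h01 h12 h23
  have n02 := hp.getVert_ne (i := 0) (j := 2) (by omega) (by omega) (by omega)
  have n03 := hp.getVert_ne (i := 0) (j := 3) (by omega) (by omega) (by omega)
  have n13 := hp.getVert_ne (i := 1) (j := 3) (by omega) (by omega) (by omega)
  have l1 := hp.not_isLeaf_getVert (i := 1) (by omega) (by omega)
  have l2 := hp.not_isLeaf_getVert (i := 2) (by omega) (by omega)
  have l3 := hp.not_isLeaf_getVert (i := 3) (by omega) (by omega)
  have l0 := hp.isLeaf_of_adj_getVert_one hac hmax (by omega) h01.symm n02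
  have x1 : p.getVert 1 ≠ x := fun h ↦ l1 (h ▸ hxl)
  have x3 : p.getVert 3 ≠ x := fun h ↦ l3 (h ▸ hxl)
  have x0 : p.getVert 0 ≠ x := by
    rintro rfl
    exact h12.ne (hxl.eq_of_adj h01 hx.symm)
  have r0 : (H.T.deleteEdges {s(p.getVert 2, p.getVert 3)}).Reachable
      (p.getVert 2) (p.getVert 0) := by
    refine reachable_deleteEdges_iff_exists_walk.2 ⟨.cons h12.symm (.cons h01.symm .nil), ?_⟩
    have := h12.ne
    simp only [Walk.edges_cons, Walk.edges_nil, List.mem_cons, List.not_mem_nil, Sym2.eq_iff]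
    grind
  have rx : (H.T.deleteEdges {s(p.getVert 2, p.getVert 3)}).Reachable (p.getVert 2) x := by
    refine reachable_deleteEdges_iff_exists_walk.2 ⟨.cons hx .nil, ?_⟩
    simp only [Walk.edges_cons, Walk.edges_nil, List.mem_cons, List.not_mem_nil, Sym2.eq_iff]
    grind
  obtain ⟨x', -, y, ⟨hyl, hyr⟩, hxy, rfl, hyx⟩ :=
    exists_adj_of_connected_induce (A := {x}) (H.planar _ _ h23) ⟨hxl, rx⟩ ⟨l0, r0⟩ rfl x0
  obtain ⟨q, hq, hqe⟩ : ∃ q : H.T.Walk (p.getVert 2) y, q.IsPath ∧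
      s(p.getVert 2, p.getVert 3) ∉ q.edges := by
    classical
    obtain ⟨q, hq⟩ := reachable_deleteEdges_iff_exists_walk.1 hyr
    exact ⟨q.bypass, q.bypass_isPath, fun h ↦ hq (q.edges_bypass_subset_edges h)⟩
  have q0 : q.length ≠ 0 := fun h ↦ l2 (Walk.eq_of_length_eq_zero h ▸ hyl)
  have a01 := q.adj_getVert_succ (i := 0) (by omega)
  rw [Walk.getVert_zero, zero_add] at a01
  have hy1 : H.T.Adj (p.getVert 1) y := by
    rcases eq_of_adj_of_ncDeg_le_three hdeg h12.symm h23 hx n13 x1 x3 a01 with h | h | h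
    · have q1 : q.length ≠ 1 := fun h' ↦ l1 (by rwa [← h, ← h', Walk.getVert_length])
      have a12 := q.adj_getVert_succ (i := 1) (by omega)
      rw [h] at a12
      have l := hp.isLeaf_of_adj_getVert_one hac hmax (by omega) a12 (by
        have := hq.getVert_ne (i := 2) (j := 0) (by omega) (by omega) (by omega)
        rwa [Walk.getVert_zero] at this)
      have q2 : q.length = 2 := by
        by_contra hne
        exact hq.not_isLeaf_getVert (i := 2) (by omega) (by omega) l
      have hend := q.getVert_length
      rw [q2] at hend
      rwa [one_add_one_eq_two, hend] at a12
    · refine absurd ((Walk.mk_mem_edges_iff_exists q).2 ⟨0, by omega, ?_⟩) hqe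
      rw [Walk.getVert_zero, zero_add, h]
    · have q1 : q.length = 1 := by
        by_contra hne
        exact hq.not_isLeaf_getVert (i := 1) (by omega) (by omega) (h ▸ hxl)
      rw [← q1, Walk.getVert_length] at h
      exact absurd h hyx
  exact hfree.not_adj (Or.inl hy1.symm) (Or.inl h12) (Or.inl hx)
    (fun h ↦ l2 (h ▸ hyl)) x1 (Or.inr hxy)

/-- Let `v` be a vertex of degree at most three with a leaf neighbour `x` and non-leaf neighbours `u`, `w`.
Then some face is incident to the path `(u, v, w)`. -/
theorem exists_adj_of_ncDeg_le_three {u v w x : V} (hu : H.T.Adj u v)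
    (hw : H.T.Adj v w) (hx : H.T.Adj v x) (hdeg : ncDeg H.T v ≤ 3) (huw : u ≠ w) (hxl : IsLeaf H.T x)
    (hul : ¬ IsLeaf H.T u) (hwl : ¬ IsLeaf H.T w) {a b : V} (ha : IsLeaf H.T a) (hb : IsLeaf H.T b)
    (hax : a ≠ x) (hbx : b ≠ x)
    (hra : (H.T.deleteEdges {s(u, v)}).Reachable u a)
    (hrb : (H.T.deleteEdges {s(u, v)}).Reachable v b) :
    ∃ w1 w2 : V, H.C.Adj w1 w2 ∧ ∀ p : H.T.Walk w1 w2, p.IsPath →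
      ∃ i, 0 < i ∧ i < p.length ∧ p.getVert i = v ∧
        ((p.getVert (i - 1) = u ∧ p.getVert (i + 1) = w) ∨
          (p.getVert (i - 1) = w ∧ p.getVert (i + 1) = u)) := by
  have hux : u ≠ x := fun h ↦ hul (h ▸ hxl)
  have hwx : w ≠ x := fun h ↦ hwl (h ▸ hxl)
  have hvl : ¬ IsLeaf H.T v := fun h ↦ huw (h.eq_of_adj hu.symm hw)
  have hreach : ∀ {y}, y ≠ x → (H.T.deleteEdges {s(v, x)}).Reachable v y :=
    hxl.reachable_deleteEdges H.tree_isTree.connected hx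
  obtain ⟨w1, ⟨hl1, hr1⟩, w2, ⟨hl2, hr2⟩, hadj, h1, h2⟩ := exists_adj_of_connected_induce
    (A := {y | (H.T.deleteEdges {s(u, v)}).Reachable u y}) (H.planar _ _ hx)
    ⟨ha, hreach hax⟩ ⟨hb, hreach hbx⟩ hra
    (fun h ↦ H.not_reachable_deleteEdges hu (Reachable.trans h hrb.symm))
  have hx1 : w1 ≠ x := by
    rintro rfl
    exact H.not_reachable_deleteEdges hx hr1
  have hx2 : w2 ≠ x := by
    rintro rfl
    exact H.not_reachable_deleteEdges hx hr2
  refine ⟨w1, w2, hadj, fun p hp ↦ ?_⟩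
  have hmem : s(u, v) ∈ p.edges := by
    by_contra h
    exact h2 (Reachable.trans h1 (reachable_deleteEdges_iff_exists_walk.2 ⟨p, h⟩))
  obtain ⟨i, hi, hil⟩ :=
    Walk.mem_support_iff_exists_getVert.1 (p.snd_mem_support_of_mem_edges hmem)
  have hi0 : 0 < i := by
    refine Nat.pos_of_ne_zero ?_
    rintro rfl
    rw [Walk.getVert_zero] at hi
    exact hvl (hi ▸ hl1)
  have hilt : i < p.length := by
    refine lt_of_le_of_ne hil ?_
    rintro rfl
    rw [Walk.getVert_length] at hi
    exact hvl (hi ▸ hl2)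
  have hnot : ∀ j ≤ p.length, p.getVert j ≠ x := by
    intro j hj h
    have hj0 : j ≠ 0 := by
      rintro rfl
      exact hx1 (by rwa [Walk.getVert_zero] at h)
    have hjl : j ≠ p.length := by
      rintro rfl
      exact hx2 (by rwa [Walk.getVert_length] at h)
    exact hp.not_isLeaf_getVert (by omega) (by omega) (h ▸ hxl)
  have hprev := p.adj_getVert_succ (i := i - 1) (by omega)
  rw [Nat.sub_add_cancel hi0, hi] at hprev
  have hnext := p.adj_getVert_succ hilt
  rw [hi] at hnext
  have hne := hp.getVert_ne (i := i - 1) (j := i + 1) (by omega) (by omega) (by omega)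
  have c1 := eq_of_adj_of_ncDeg_le_three hdeg hu.symm hw hx huw hux hwx hprev.symm
  have c2 := eq_of_adj_of_ncDeg_le_three hdeg hu.symm hw hx huw hux hwx hnext
  have n1 := hnot (i - 1) (by omega)
  have n2 := hnot (i + 1) (by omega)
  exact ⟨i, hi0, hilt, hi, by grind⟩

end HalinGraph

/-- If the characteristic tree of a `C₄`-free Halin graph has a longest path of length
at least `6`, then (i) it contains a semi-branching vertex of degree at least `4`, or
(ii) it contains a path `(u, v, w)` with `v` semi-branching of degree `3` whose
incident bounded face has size at least `6`, or (iii) it contains a tree edge with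
both endpoints non-leaves whose two incident bounded faces both have size at least
`6`. -/
theorem longest_path_six_reduction {V : Type*} [Fintype V] (H : HalinGraph V)
    (hfree : C4Free H.graph)
    (hlong : ∃ (a b : V) (p : H.T.Walk a b), p.IsPath ∧ 6 ≤ p.length) :
    (∃ v : V, SemiBranching H.T v ∧ 4 ≤ ncDeg H.T v) ∨
    (∃ u v w : V, H.T.Adj u v ∧ H.T.Adj v w ∧ u ≠ w ∧
      SemiBranching H.T v ∧ ncDeg H.T v = 3 ∧
      ∃ w1 w2 : V, H.C.Adj w1 w2 ∧
        (∀ p : H.T.Walk w1 w2, p.IsPath → s(u, v) ∈ p.edges ∧ s(v, w) ∈ p.edges) ∧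
        6 ≤ H.T.dist w1 w2 + 1) ∨
    (∃ u v : V, H.T.Adj u v ∧ ¬ IsLeaf H.T u ∧ ¬ IsLeaf H.T v ∧
      ∀ w1 w2 : V, H.C.Adj w1 w2 →
        (∀ p : H.T.Walk w1 w2, p.IsPath → s(u, v) ∈ p.edges) →
        6 ≤ H.T.dist w1 w2 + 1) := by
  have hac := H.tree_isTree.isAcyclic
  obtain ⟨a₀, b₀, p₀, hp₀, hlen₀⟩ := hlong
  have : Nonempty V := ⟨a₀⟩
  obtain ⟨a, b, p, hp, hmax⟩ := Walk.exists_isPath_forall_isPath_length_le_length H.T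
  have hlen : 6 ≤ p.length := hlen₀.trans (hmax _ _ _ hp₀)
  by_cases hbig : ∃ v : V, SemiBranching H.T v ∧ 4 ≤ ncDeg H.T v
  · exact Or.inl hbig
  refine Or.inr ?_
  have hdeg : ∀ v, SemiBranching H.T v → ncDeg H.T v ≤ 3 := fun v hv ↦ by
    by_contra h
    exact hbig ⟨v, hv, by omega⟩
  have h01 := p.adj_getVert_succ (i := 0) (by omega)
  have h12 := p.adj_getVert_succ (i := 1) (by omega)
  have h23 := p.adj_getVert_succ (i := 2) (by omega)
  have h34 := p.adj_getVert_succ (i := 3) (by omega)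
  simp only [Nat.reduceAdd] at h01 h12 h23 h34
  have n02 := hp.getVert_ne (i := 0) (j := 2) (by omega) (by omega) (by omega)
  have n13 := hp.getVert_ne (i := 1) (j := 3) (by omega) (by omega) (by omega)
  have n24 := hp.getVert_ne (i := 2) (j := 4) (by omega) (by omega) (by omega)
  have l1 := hp.not_isLeaf_getVert (i := 1) (by omega) (by omega)
  have l2 := hp.not_isLeaf_getVert (i := 2) (by omega) (by omega)
  have l3 := hp.not_isLeaf_getVert (i := 3) (by omega) (by omega)
  have l4 := hp.not_isLeaf_getVert (i := 4) (by omega) (by omega)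
  have hn2 : ∀ x, H.T.Adj (p.getVert 2) x → ¬ IsLeaf H.T x := fun x hx hxl ↦
    H.not_isLeaf_of_adj_getVert_two hfree hp hmax (by omega)
      (hdeg _ ⟨l2, ⟨x, hx, hxl⟩, _, _, n13, h12.symm, h23, l1, l3⟩) hx hxl
  by_cases hn3 : ∀ x, H.T.Adj (p.getVert 3) x → ¬ IsLeaf H.T x
  · refine Or.inr ⟨_, _, h23, l2, l3, fun w1 w2 hadj hpath ↦ ?_⟩
    obtain ⟨q, hq, hql⟩ := H.tree_isTree.connected.exists_path_of_dist w1 w2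
    have := q.five_le_length_of_mem_edges (H.isLeaf_left_of_adj hadj)
      (H.isLeaf_left_of_adj hadj.symm) (hpath q hq) l2 hn2 l3 hn3
    omega
  push Not at hn3
  obtain ⟨x, hx, hxl⟩ := hn3
  have hsemi : SemiBranching H.T (p.getVert 3) :=
    ⟨l3, ⟨x, hx, hxl⟩, _, _, n24, h23.symm, h34, l2, l4⟩
  have l0 : IsLeaf H.T a := by
    have := hp.isLeaf_of_adj_getVert_one hac hmax (by omega) h01.symm n02
    rwa [Walk.getVert_zero] at this
  have lb : IsLeaf H.T b := by
    have := hp.reverse.isLeaf_of_adj_getVert_one hac (by simpa using hmax) (by simp; omega)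
      (p.reverse.adj_getVert_succ (i := 0) (by simp; omega)).symm
      (hp.reverse.getVert_ne (by omega) (by simp; omega) (by omega))
    rwa [Walk.getVert_zero] at this
  have hax : a ≠ x := by
    rintro rfl
    rw [Walk.getVert_zero] at h01
    exact n13 (hxl.eq_of_adj h01 hx.symm)
  have hbx : b ≠ x := by
    rintro rfl
    have h := p.adj_getVert_succ (i := p.length - 1) (by omega)
    rw [Nat.sub_add_cancel (by omega), Walk.getVert_length] at h
    exact hp.getVert_ne (by omega) (by omega) (by omega) (hxl.eq_of_adj h.symm hx.symm)
  have hra : (H.T.deleteEdges {s(p.getVert 2, p.getVert 3)}).Reachable (p.getVert 2) a := by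
    refine reachable_deleteEdges_iff_exists_walk.2 ⟨(p.take 2).reverse, fun h ↦ ?_⟩
    obtain ⟨j, hj, hj'⟩ := Walk.mem_support_iff_exists_getVert.1
      (Walk.snd_mem_support_of_mem_edges _ h)
    rw [Walk.getVert_reverse, Walk.take_getVert] at hj
    exact hp.getVert_ne (by omega) (by omega) (by omega) hj
  have hrb : (H.T.deleteEdges {s(p.getVert 2, p.getVert 3)}).Reachable (p.getVert 3) b := by
    refine reachable_deleteEdges_iff_exists_walk.2 ⟨p.drop 3, fun h ↦ ?_⟩
    obtain ⟨j, hj, hj'⟩ := Walk.mem_support_iff_exists_getVert.1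
      (Walk.fst_mem_support_of_mem_edges _ h)
    rw [Walk.drop_length] at hj'
    rw [Walk.drop_getVert] at hj
    exact hp.getVert_ne (by omega) (by omega) (by omega) hj
  obtain ⟨w1, w2, hadj, hpath⟩ := H.exists_adj_of_ncDeg_le_three h23 h34 hx (hdeg _ hsemi) n24 hxl
    l2 l4 l0 lb hax hbx hra hrb
  refine Or.inl ⟨_, _, _, h23, h34, n24, hsemi,
    le_antisymm (hdeg _ hsemi) (H.nonleaf_degree _ l3), w1, w2, hadj, fun q hq ↦ ?_, ?_⟩
  · obtain ⟨i, hi0, hil, hi, h⟩ := hpath q hq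
    have e1 := (Walk.mk_mem_edges_iff_exists q).2 ⟨i - 1, by omega, rfl⟩
    have e2 := (Walk.mk_mem_edges_iff_exists q).2 ⟨i, hil, rfl⟩
    rw [Nat.sub_add_cancel hi0, hi] at e1
    rw [hi] at e2
    rcases h with ⟨h1, h2⟩ | ⟨h1, h2⟩
    · rw [h1] at e1
      rw [h2] at e2
      exact ⟨e1, e2⟩
    · rw [h1, Sym2.eq_swap] at e1
      rw [h2, Sym2.eq_swap] at e2
      exact ⟨e2, e1⟩
  · obtain ⟨q, hq, hql⟩ := H.tree_isTree.connected.exists_path_of_dist w1 w2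
    have hw1 := H.isLeaf_left_of_adj hadj
    have hw2 := H.isLeaf_left_of_adj hadj.symm
    obtain ⟨i, hi0, hil, hi, h⟩ := hpath q hq
    rcases h with ⟨h1, h2⟩ | ⟨h1, h2⟩
    · have := q.two_le_of_getVert_eq hw1 (by omega) h1 l2 hn2
      have : i + 1 ≠ q.length := by
        rintro h
        rw [h, Walk.getVert_length] at h2
        exact l4 (h2 ▸ hw2)
      omega
    · have := q.add_two_le_of_getVert_eq hw2 (by omega) h2 l2 hn2
      have : i - 1 ≠ 0 := by
        rintro h
        rw [h, Walk.getVert_zero] at h1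
        exact l4 (h1 ▸ hw1)
      omega
end

section
/- Let H be an 18-vertex C4-free Halin graph with characteristic tree T. If the longest path in T has length exactly 7, then e(H) = 27. -/
open SimpleGraph

section Aux

variable {V : Type*} {G : SimpleGraph V}

lemma ncard_pair_le (x y : V) : ({x, y} : Set V).ncard ≤ 2 :=
  (Set.ncard_insert_le x {y}).trans (by simp)

lemma ncard_setOf_eq_card_filter [Fintype V] (p : V → Prop) [DecidablePred p] :
    {v | p v}.ncard = (Finset.univ.filter p).card := by
  rw [← Set.ncard_coe_finset, Finset.coe_filter_univ]

lemma C4Free.eq_or_eq (hG : C4Free G) {a b c d : V} (hab : G.Adj a b) (hbc : G.Adj b c)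
    (hcd : G.Adj c d) (hda : G.Adj d a) : a = c ∨ b = d := by
  by_contra! hne
  refine hG a (.cons hab (.cons hbc (.cons hcd (.cons hda .nil)))) ?_ rfl
  have := hab.ne
  have := hbc.ne
  have := hcd.ne
  have := hda.ne
  simp [Walk.cons_isCycle_iff]
  grind

lemma isPath_cons_cons_iff (hG : G.IsAcyclic) {u v w x : V} (h : G.Adj u v) (h' : G.Adj v w)
    (p : G.Walk w x) :
    (Walk.cons h (.cons h' p)).IsPath ↔ u ≠ w ∧ (Walk.cons h' p).IsPath := by
  rw [hG.isPath_iff_isChain, hG.isPath_iff_isChain]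
  simp only [Walk.edges_cons, List.isChain_cons_cons]
  have := h.ne
  have := h'.ne
  refine and_congr_left fun _ ↦ not_congr ?_
  simp only [Sym2.eq_iff]
  grind

lemma IsLeaf.eq_of_adj_s18 {v x y : V} (hv : IsLeaf G v) (hx : G.Adj v x) (hy : G.Adj v y) :
    x = y := by
  obtain ⟨a, ha⟩ := Set.ncard_eq_one.1 hv
  have hx' : x ∈ G.neighborSet v := hx
  have hy' : y ∈ G.neighborSet v := hy
  rw [ha] at hx' hy'
  exact hx'.trans hy'.symm

lemma not_isLeaf_of_adj {v x y : V} (hx : G.Adj v x) (hy : G.Adj v y) (hxy : x ≠ y) :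
    ¬ IsLeaf G v :=
  fun hv ↦ hxy (hv.eq_of_adj_s18 hx hy)

lemma ncDeg_eq_degree [Fintype V] [DecidableRel G.Adj] (v : V) : ncDeg G v = G.degree v := by
  rw [ncDeg, Set.ncard_eq_toFinset_card', Set.toFinset_card, card_neighborSet_eq_degree]

lemma sum_ncDeg [Fintype V] : ∑ v, ncDeg G v = 2 * eCount G := by
  classical
  simp_rw [ncDeg_eq_degree, sum_degrees_eq_twice_card_edges, eCount, ← coe_edgeFinset,
    Set.ncard_coe_finset]

end Aux

namespace HalinGraph

variable {V : Type*} [Fintype V] (H : HalinGraph V)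

lemma exists_adj_ne_ne {v : V} (hv : ¬ IsLeaf H.T v) (x y : V) :
    ∃ z, H.T.Adj v z ∧ z ≠ x ∧ z ≠ y := by
  have h3 := H.nonleaf_degree v hv
  have h2 : ({x, y} : Set V).ncard < (H.T.neighborSet v).ncard :=
    (ncard_pair_le x y).trans_lt h3
  obtain ⟨z, hz, hzn⟩ := Set.exists_mem_notMem_of_ncard_lt_ncard h2
  exact ⟨z, hz, by grind⟩

/-- Along a longest path of length seven, the third vertex from an end has a third non-leaf
neighbour. -/
lemma exists_nonleaf_branch (hfree : C4Free H.graph)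
    (hmax : ∀ (a b : V) (p : H.T.Walk a b), p.IsPath → p.length ≤ 7)
    {v₀ v₁ v₂ v₃ b : V} (h01 : H.T.Adj v₀ v₁) (h12 : H.T.Adj v₁ v₂) (h23 : H.T.Adj v₂ v₃)
    (q : H.T.Walk v₃ b) (h : (Walk.cons h01 (.cons h12 (.cons h23 q))).IsPath)
    (hq : q.length = 4) (h3 : ¬ IsLeaf H.T v₃) :
    ∃ w, H.T.Adj v₂ w ∧ ¬ IsLeaf H.T w ∧ w ≠ v₁ ∧ w ≠ v₃ := by
  have hT := H.tree_isTree.isAcyclic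
  rw [isPath_cons_cons_iff hT] at h
  obtain ⟨h02, hp⟩ := h
  have h13 := ((isPath_cons_cons_iff hT _ _ _).1 hp).1
  have leaf1 : ∀ w, H.T.Adj v₁ w → w ≠ v₂ → IsLeaf H.T w := by
    intro w hw hw2
    by_contra hl
    obtain ⟨u, hu, hu1, -⟩ := H.exists_adj_ne_ne hl v₁ v₁
    have := hmax _ _ (.cons hu.symm (.cons hw.symm (.cons h12 (.cons h23 q))))
      (by rw [isPath_cons_cons_iff hT, isPath_cons_cons_iff hT]; exact ⟨hu1, hw2, hp⟩)
    simp [hq] at this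
  have n1 : ¬ IsLeaf H.T v₁ := not_isLeaf_of_adj h01.symm h12 h02
  have n2 : ¬ IsLeaf H.T v₂ := not_isLeaf_of_adj h12.symm h23 h13
  by_contra! hno
  have leaf2 : ∀ w, H.T.Adj v₂ w → w ≠ v₁ → w ≠ v₃ → IsLeaf H.T w := by
    intro w hw hw1 hw3
    by_contra hl
    exact hw3 (hno w hw hl hw1)
  obtain ⟨y, hy, hy1, hy3⟩ := H.exists_adj_ne_ne n2 v₁ v₃
  have ly := leaf2 y hy hy1 hy3
  have l0 := leaf1 v₀ h01.symm h02
  -- every leaf on the `v₂` side hangs from `v₁` or `v₂`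
  have side : ∀ z, (H.T.deleteEdges {s(v₂, v₃)}).Reachable v₂ z →
      z = v₁ ∨ z = v₂ ∨ IsLeaf H.T z ∧ (H.T.Adj v₁ z ∨ H.T.Adj v₂ z) := by
    rintro z ⟨p⟩
    by_contra hz
    obtain ⟨d, -, hd, hd'⟩ := p.exists_boundary_dart
      {z | z = v₁ ∨ z = v₂ ∨ IsLeaf H.T z ∧ (H.T.Adj v₁ z ∨ H.T.Adj v₂ z)} (by simp) hz
    have had := d.adj
    simp only [deleteEdges_adj, Set.mem_singleton_iff] at had
    obtain ⟨had, hne⟩ := had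
    simp only [Set.mem_ofPred_eq] at hd hd'
    rcases hd with hd | hd | ⟨hl, hd | hd⟩
    · rw [hd] at had
      grind
    · rw [hd] at had hne
      grind
    · exact hd' (.inl (hl.eq_of_adj_s18 had hd.symm))
    · exact hd' (.inr (.inl (hl.eq_of_adj_s18 had hd.symm)))
  have adj_del : ∀ {a c}, H.T.Adj a c → a ≠ v₃ → c ≠ v₃ →
      (H.T.deleteEdges {s(v₂, v₃)}).Adj a c := by
    intro a c hac ha hc
    simp only [deleteEdges_adj, Set.mem_singleton_iff, Sym2.eq_iff]
    grind
  have h03 : v₀ ≠ v₃ := fun e ↦ h3 (e ▸ l0)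
  have hr1 := adj_del h12.symm h23.ne h13
  obtain ⟨p⟩ := (H.planar v₂ v₃ h23).preconnected
    ⟨v₀, l0, hr1.reachable.trans (adj_del h01.symm h13 h03).reachable⟩
    ⟨y, ly, (adj_del hy h23.ne hy3).reachable⟩
  obtain ⟨⟨⟨x, z⟩, hxz⟩, -, hx, hz⟩ := p.exists_boundary_dart {x | H.T.Adj v₁ x.1} h01.symm
    (fun h1 ↦ h12.ne (ly.eq_of_adj_s18 h1.symm hy.symm))
  obtain ⟨x, lx, rx⟩ := x
  obtain ⟨z, lz, rz⟩ := z
  simp only [comap_adj, Function.Embedding.subtype_apply] at hxz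
  simp only [Set.mem_ofPred_eq] at hx hz
  have h2z : H.T.Adj v₂ z := by
    rcases side z rz with rfl | rfl | ⟨-, h | h⟩
    · exact absurd lz n1
    · exact absurd lz n2
    · exact absurd h hz
    · exact h
  rcases hfree.eq_or_eq (a := v₁) (b := x) (c := z) (d := v₂) (.inl hx) (.inr hxz)
    (.inl h2z.symm) (.inl h12.symm) with rfl | rfl
  · exact n1 lz
  · exact n2 lx

lemma edgeSet_disjoint (hcard : 2 < Fintype.card V) :
    Disjoint H.T.edgeSet H.C.edgeSet := by
  rw [Set.disjoint_left]
  intro e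
  induction e with | _ x y
  intro hT hC
  rw [mem_edgeSet] at hT hC
  have hs {a b} (h : H.C.Adj a b) : IsLeaf H.T a := by
    have : a ∈ H.C.support := ⟨b, h⟩
    rwa [H.support_C] at this
  have lx := hs hC
  have ly := hs hC.symm
  have huniv : ∀ z, z = x ∨ z = y := by
    intro z
    by_contra hz
    obtain ⟨p⟩ := H.tree_isTree.connected.preconnected x z
    obtain ⟨d, -, hd, hd'⟩ := p.exists_boundary_dart {z | z = x ∨ z = y} (by simp) hz
    have := d.adj
    simp only [Set.mem_ofPred_eq] at hd hd'
    rcases hd with h | h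
    · rw [h] at this
      exact hd' (.inr (lx.eq_of_adj_s18 this hT))
    · rw [h] at this
      exact hd' (.inl (ly.eq_of_adj_s18 this hT.symm))
  have : (Set.univ : Set V).ncard ≤ 2 :=
    (Set.ncard_le_ncard (t := {x, y}) (fun z _ ↦ by simpa using huniv z)).trans
      (ncard_pair_le x y)
  rw [Set.ncard_univ, Nat.card_eq_fintype_card] at this
  omega

lemma eCount_T : eCount H.T + 1 = Fintype.card V := by
  classical
  rw [← H.tree_isTree.card_edgeFinset, eCount, ← coe_edgeFinset, Set.ncard_coe_finset]

lemma eCount_C : eCount H.C = {v | IsLeaf H.T v}.ncard := by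
  classical
  have h : ∀ v, ncDeg H.C v = if IsLeaf H.T v then 2 else 0 := by
    intro v
    have hmem : v ∈ H.C.support ↔ IsLeaf H.T v := by rw [H.support_C]; rfl
    split_ifs with hv
    · exact H.two_regular v (hmem.2 hv)
    · rw [← hmem] at hv
      rw [ncDeg, Set.ncard_eq_zero]
      exact Set.eq_empty_of_forall_notMem fun w hw ↦ hv ⟨w, hw⟩
  have hsum := sum_ncDeg (G := H.C)
  simp_rw [h, Finset.sum_ite, Finset.sum_const_zero, Finset.sum_const, smul_eq_mul] at hsum
  rw [← ncard_setOf_eq_card_filter] at hsum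
  omega

/-- There are more leaves than non-leaves, by at least two. -/
lemma card_add_two_le : Fintype.card V + 2 ≤ 2 * {v | IsLeaf H.T v}.ncard := by
  classical
  have h : ∀ v, 3 ≤ ncDeg H.T v + if IsLeaf H.T v then 2 else 0 := by
    intro v
    split_ifs with hv
    · rw [hv]
    · exact H.nonleaf_degree v hv
  have hsum := Finset.sum_le_sum fun v (_ : v ∈ Finset.univ) ↦ h v
  simp_rw [Finset.sum_add_distrib, sum_ncDeg, Finset.sum_ite, Finset.sum_const_zero,
    Finset.sum_const, smul_eq_mul, Finset.card_univ] at hsum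
  have := H.eCount_T
  rw [← ncard_setOf_eq_card_filter] at hsum
  omega

lemma eight_le_card_nonleaf (hfree : C4Free H.graph)
    (hex : ∃ (a b : V) (p : H.T.Walk a b), p.IsPath ∧ p.length = 7)
    (hmax : ∀ (a b : V) (p : H.T.Walk a b), p.IsPath → p.length ≤ 7) :
    8 ≤ {v | ¬ IsLeaf H.T v}.ncard := by
  classical
  have hT := H.tree_isTree.isAcyclic
  obtain ⟨v₀, v₇, p, hp, hlen⟩ := hex
  rcases p with _ | @⟨_, v₁, _, h01, _ | @⟨_, v₂, _, h12, _ | @⟨_, v₃, _, h23,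
    _ | @⟨_, v₄, _, h34, _ | @⟨_, v₅, _, h45, _ | @⟨_, v₆, _, h56,
    _ | @⟨_, _, _, h67, _ | _⟩⟩⟩⟩⟩⟩⟩ <;> simp [Walk.length_cons] at hlen
  have hp' := hp
  simp only [isPath_cons_cons_iff hT] at hp'
  obtain ⟨h02, h13, h24, h35, h46, h57, -⟩ := hp'
  have n1 := not_isLeaf_of_adj h01.symm h12 h02
  have n2 := not_isLeaf_of_adj h12.symm h23 h13
  have n3 := not_isLeaf_of_adj h23.symm h34 h24
  have n4 := not_isLeaf_of_adj h34.symm h45 h35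
  have n5 := not_isLeaf_of_adj h45.symm h56 h46
  have n6 := not_isLeaf_of_adj h56.symm h67 h57
  obtain ⟨w, hw, nw, hw1, hw3⟩ := H.exists_nonleaf_branch hfree hmax h01 h12 h23 _ hp rfl n3
  obtain ⟨w', hw', nw', hw6, hw4⟩ := H.exists_nonleaf_branch hfree hmax h67.symm h56.symm h45.symm
    (.cons h34.symm (.cons h23.symm (.cons h12.symm (.cons h01.symm .nil))))
    (by simpa [isPath_cons_cons_iff hT, h67.ne] using hp.reverse) rfl n4
  have P {x y : V} (hx : H.T.Adj x v₂) (hy : H.T.Adj v₅ y) (hx3 : x ≠ v₃) (hy4 : y ≠ v₄) :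
      [x, v₂, v₃, v₄, v₅, y].Nodup := by
    have : (Walk.cons hx (.cons h23 (.cons h34 (.cons h45 (.cons hy .nil))))).IsPath := by
      simp only [isPath_cons_cons_iff hT]
      simp [hx3, h24, h35, hy4.symm, hy.ne]
    simpa using this.support_nodup
  have a := P h12 h56 h13 h46.symm
  have b := P hw.symm h56 hw3 h46.symm
  have c := P h12 hw' h13 hw4
  have d := P hw.symm hw' hw3 hw4
  have hnd : [v₁, v₂, v₃, v₄, v₅, v₆, w, w'].Nodup := by
    simp only [List.nodup_cons, List.mem_cons, List.not_mem_nil] at a b c d ⊢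
    grind
  have hcard := List.toFinset_card_of_nodup hnd
  rw [show 8 = [v₁, v₂, v₃, v₄, v₅, v₆, w, w'].length from rfl, ← hcard, ← Set.ncard_coe_finset]
  refine Set.ncard_le_ncard fun x hx ↦ ?_
  simp only [List.coe_toFinset, List.mem_cons, List.not_mem_nil, or_false,
    Set.mem_ofPred_eq] at hx ⊢
  grind

end HalinGraph

/-- An `18`-vertex `C₄`-free Halin graph whose characteristic tree has a longest path
of length exactly `7` has exactly `27` edges. -/
theorem halin_eighteen_longest_seven {V : Type*} [Fintype V]
    (hcard : Fintype.card V = 18) (H : HalinGraph V) (hfree : C4Free H.graph)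
    (hex : ∃ (a b : V) (p : H.T.Walk a b), p.IsPath ∧ p.length = 7)
    (hmax : ∀ (a b : V) (p : H.T.Walk a b), p.IsPath → p.length ≤ 7) :
    eCount H.graph = 27 := by
  have h8 := H.eight_le_card_nonleaf hfree hex hmax
  have hle := H.card_add_two_le
  have hT := H.eCount_T
  have hC := H.eCount_C
  have hcompl := Set.ncard_add_ncard_compl {v | IsLeaf H.T v}
  rw [Set.compl_ofPred, Nat.card_eq_fintype_card] at hcompl
  have hsum : eCount H.graph = eCount H.T + eCount H.C := by
    rw [eCount, HalinGraph.graph, edgeSet_sup,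
      Set.ncard_union_eq (H.edgeSet_disjoint (by omega))]
    rfl
  omega
end
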